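/- arXiv:1411.2404 — 3 statements merged into one kernel-verified Lean document; each statement's English description precedes it below -/
import Mathlib

section
/- For any integer n > 1 and any 0 < ε < 1/2, there exists a universal constant c > 0 and a set V ⊂ ℝ^n of exactly n³ + n vectors such that the following holds: for any positive integer m and any matrix A ∈ ℝ^{m×n}, if (1−ε)‖v‖₂² ≤ ‖Av‖₂² ≤ (1+ε)‖v‖₂² for every v ∈ V, then m ≥ c · min{n, ε^{−2} · ln n}. -/
open Matrix

/-- Integer vectors supported in `S` whose squared Euclidean norm is at most `4 * k`. -/
noncomputable def intNet {n : ℕ} (S : Finset (Fin n)) (k : ℕ) : Finset (Fin n → ℤ) :=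
  (Fintype.piFinset fun i => if i ∈ S then Finset.Icc (-(4 * k : ℕ) : ℤ) (4 * k : ℕ) else {0}).filter
    fun z => ∑ i, z i ^ 2 ≤ 4 * (k : ℤ)

theorem sum_Icc_half_pow_natAbs (M : ℕ) :
    ∑ j ∈ Finset.Icc (-M : ℤ) M, (1 / 2 : ℝ) ^ j.natAbs = 3 - 2 * (1 / 2) ^ M := by
  induction M with
  | zero => norm_num
  | succ M ih =>
    have h : Finset.Icc (-(M + 1 : ℕ) : ℤ) (M + 1 : ℕ) =
        insert (-(M + 1 : ℕ) : ℤ) (insert ((M + 1 : ℕ) : ℤ) (Finset.Icc (-M : ℤ) M)) := by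
      ext x
      simp only [Finset.mem_Icc, Finset.mem_insert]
      omega
    rw [h, Finset.sum_insert, Finset.sum_insert, ih]
    · rw [Int.natAbs_neg, Int.natAbs_natCast, pow_succ]
      ring
    · simp only [Finset.mem_Icc]
      omega
    · simp only [Finset.mem_Icc, Finset.mem_insert]
      omega

theorem card_intNet_le {n k : ℕ} (S : Finset (Fin n)) (hS : S.card ≤ k) :
    (intNet S k).card ≤ 48 ^ k := by
  set t : Fin n → Finset ℤ :=
    fun i => if i ∈ S then Finset.Icc (-(4 * k : ℕ) : ℤ) (4 * k : ℕ) else {0} with ht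
  have hlow : ∀ z ∈ intNet S k, (1 / 2 : ℝ) ^ (4 * k) ≤ ∏ i, (1 / 2 : ℝ) ^ (z i).natAbs := by
    intro z hz
    rw [Finset.prod_pow_eq_pow_sum]
    apply pow_le_pow_of_le_one (by norm_num) (by norm_num)
    have h := (Finset.mem_filter.1 hz).2
    have h2 : ∑ i, ((z i).natAbs : ℤ) ≤ ∑ i, z i ^ 2 := by
      refine Finset.sum_le_sum fun i _ => ?_
      exact Int.natAbs_le_self_sq (z i)
    zify
    push_cast at h2
    linarith
  have hup : ∑ z ∈ intNet S k, ∏ i, (1 / 2 : ℝ) ^ (z i).natAbs ≤ 3 ^ k := by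
    calc ∑ z ∈ intNet S k, ∏ i, (1 / 2 : ℝ) ^ (z i).natAbs
        ≤ ∑ z ∈ Fintype.piFinset t, ∏ i, (1 / 2 : ℝ) ^ (z i).natAbs := by
          apply Finset.sum_le_sum_of_subset_of_nonneg (Finset.filter_subset _ _)
          intros
          positivity
      _ = ∏ i, ∑ j ∈ t i, (1 / 2 : ℝ) ^ j.natAbs := by
          rw [Finset.prod_univ_sum]
      _ ≤ ∏ i, (if i ∈ S then 3 else 1 : ℝ) := by
          refine Finset.prod_le_prod (fun i _ => Finset.sum_nonneg fun _ _ => by positivity)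
            fun i _ => ?_
          by_cases hi : i ∈ S
          · simp only [ht, hi, if_true]
            rw [sum_Icc_half_pow_natAbs]
            have : (0 : ℝ) ≤ (1 / 2) ^ (4 * k) := by positivity
            linarith
          · simp [ht, hi]
      _ = 3 ^ S.card := by
          rw [Finset.prod_ite_mem, Finset.univ_inter, Finset.prod_const]
      _ ≤ 3 ^ k := pow_le_pow_right₀ (by norm_num) hS
  have h := (Finset.card_nsmul_le_sum _ _ _ hlow).trans hup
  rw [nsmul_eq_mul, pow_mul, one_div, inv_pow, inv_pow, ← div_eq_mul_inv,
    div_le_iff₀ (by positivity), ← mul_pow] at h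
  norm_num at h
  exact_mod_cast h

theorem exists_int_truncation (w : ℝ) :
    ∃ z : ℤ, (z : ℝ) ^ 2 ≤ w ^ 2 ∧ 3 / 4 * w ^ 2 - 1 ≤ w * z := by
  rcases le_total 0 w with hw | hw
  · refine ⟨⌊w⌋, ?_, ?_⟩
    · have h0 : (0 : ℝ) ≤ ⌊w⌋ := by exact_mod_cast Int.floor_nonneg.2 hw
      nlinarith [Int.floor_le w]
    · nlinarith [Int.lt_floor_add_one w, sq_nonneg (w / 2 - 1)]
  · refine ⟨⌈w⌉, ?_, ?_⟩
    · have h0 : (⌈w⌉ : ℝ) ≤ 0 := by exact_mod_cast Int.ceil_nonpos.2 hw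
      nlinarith [Int.le_ceil w]
    · nlinarith [Int.ceil_lt_add_one w, sq_nonneg (w / 2 + 1)]

theorem neg_mem_intNet {n k : ℕ} {S : Finset (Fin n)} {z : Fin n → ℤ} (hz : z ∈ intNet S k) :
    -z ∈ intNet S k := by
  simp only [intNet, Finset.mem_filter, Fintype.mem_piFinset, Pi.neg_apply, neg_sq] at hz ⊢
  refine ⟨fun i => ?_, hz.2⟩
  have := hz.1 i
  split_ifs at this ⊢
  · simp only [Finset.mem_Icc] at this ⊢
    omega
  · simpa using this

theorem sum_sq_le_of_mem_intNet {n k : ℕ} {S : Finset (Fin n)} {z : Fin n → ℤ}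
    (hz : z ∈ intNet S k) : ∑ i, (z i : ℝ) ^ 2 ≤ 4 * k := by
  exact_mod_cast (Finset.mem_filter.1 hz).2

/-- The net detects a constant fraction of the norm of any vector restricted to `S`. -/
theorem exists_mem_intNet_correlated {n k : ℕ} (S : Finset (Fin n)) (hS : S.card ≤ k)
    (b : Fin n → ℝ) :
    ∃ z ∈ intNet S k, (∑ i ∈ S, b i ^ 2) * k ≤ (∑ i, b i * z i) ^ 2 := by
  set s := ∑ i ∈ S, b i ^ 2 with hs
  have hs0 : 0 ≤ s := Finset.sum_nonneg fun _ _ => sq_nonneg _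
  rcases hs0.eq_or_lt with h0 | hpos
  · refine ⟨0, ?_, ?_⟩
    · simp only [intNet, Finset.mem_filter, Fintype.mem_piFinset]
      refine ⟨fun i => ?_, by simp⟩
      split_ifs <;> simp
    · rw [← h0]
      simp
  set r := 2 * √(k : ℝ) / √s with hr
  have hr2 : r ^ 2 * s = 4 * k := by
    rw [hr, div_pow, mul_pow, Real.sq_sqrt hs0, Real.sq_sqrt (Nat.cast_nonneg k)]
    field_simp
    ring
  choose f hf1 hf2 using fun i => exists_int_truncation (r * b i)
  set z : Fin n → ℤ := fun i => if i ∈ S then f i else 0 with hz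
  have hz2 : ∑ i, (z i : ℝ) ^ 2 ≤ 4 * k := by
    calc ∑ i, (z i : ℝ) ^ 2 = ∑ i ∈ S, (f i : ℝ) ^ 2 := by
          rw [← Finset.sum_subset (Finset.subset_univ S)]
          · exact Finset.sum_congr rfl fun i hi => by simp [hz, hi]
          · intro i _ hi
            simp [hz, hi]
      _ ≤ ∑ i ∈ S, (r * b i) ^ 2 := Finset.sum_le_sum fun i _ => hf1 i
      _ = 4 * k := by
          rw [← hr2, hs, Finset.mul_sum]
          exact Finset.sum_congr rfl fun i _ => by ring
  have hz2' : ∑ i, z i ^ 2 ≤ 4 * (k : ℤ) := by exact_mod_cast hz2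
  have hcor : 2 * (k : ℝ) ≤ r * ∑ i, b i * z i := by
    calc 2 * (k : ℝ) ≤ 3 / 4 * (4 * k) - S.card := by
          have : (S.card : ℝ) ≤ k := by exact_mod_cast hS
          linarith
      _ = ∑ i ∈ S, (3 / 4 * (r * b i) ^ 2 - 1) := by
          rw [Finset.sum_sub_distrib, ← Finset.mul_sum, ← hr2, hs, Finset.mul_sum]
          simp [mul_pow]
      _ ≤ ∑ i ∈ S, r * b i * f i := Finset.sum_le_sum fun i _ => hf2 i
      _ = r * ∑ i, b i * z i := by
          rw [Finset.mul_sum, ← Finset.sum_subset (Finset.subset_univ S)]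
          · exact Finset.sum_congr rfl fun i hi => by simp [hz, hi, mul_assoc]
          · intro i _ hi
            simp [hz, hi]
  refine ⟨z, ?_, ?_⟩
  · simp only [intNet, Finset.mem_filter, Fintype.mem_piFinset]
    refine ⟨fun i => ?_, hz2'⟩
    by_cases hi : i ∈ S
    · have h1 : z i ^ 2 ≤ 4 * (k : ℤ) :=
        (Finset.single_le_sum (f := fun i => z i ^ 2) (fun _ _ => sq_nonneg _)
          (Finset.mem_univ i)).trans hz2'
      have h2 := Int.natAbs_le_self_sq (z i)
      simp only [hi, if_true, Finset.mem_Icc]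
      push_cast
      omega
    · simp [hi, hz]
  · rcases (Nat.cast_nonneg k : (0 : ℝ) ≤ k).eq_or_lt with hk | hk
    · rw [← hk, mul_zero]
      positivity
    have h1 : (2 * (k : ℝ)) ^ 2 ≤ (r * ∑ i, b i * z i) ^ 2 :=
      pow_le_pow_left₀ (by positivity) hcor 2
    have h2 : (4 * k : ℝ) * (s * k) ≤ (4 * k) * (∑ i, b i * z i) ^ 2 := by
      calc (4 * k : ℝ) * (s * k) = s * (2 * (k : ℝ)) ^ 2 := by ring
        _ ≤ s * (r * ∑ i, b i * z i) ^ 2 := by gcongr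
        _ = (r ^ 2 * s) * (∑ i, b i * z i) ^ 2 := by ring
        _ = _ := by rw [hr2]
    exact le_of_mul_le_mul_left h2 (by positivity)

/-- If `A` preserves the squared norms of `u + z` and `u - z` up to `1 ± ε`, it nearly preserves
the inner product of `u` and `z`. -/
theorem abs_dotProduct_mulVec_sub_le {m n : ℕ} (A : Matrix (Fin m) (Fin n) ℝ) {ε : ℝ}
    (u z : Fin n → ℝ)
    (hadd : (1 - ε) * (∑ i, ((u + z) i) ^ 2) ≤ ∑ i, (A.mulVec (u + z) i) ^ 2 ∧
      ∑ i, (A.mulVec (u + z) i) ^ 2 ≤ (1 + ε) * ∑ i, ((u + z) i) ^ 2)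
    (hsub : (1 - ε) * (∑ i, ((u + -z) i) ^ 2) ≤ ∑ i, (A.mulVec (u + -z) i) ^ 2 ∧
      ∑ i, (A.mulVec (u + -z) i) ^ 2 ≤ (1 + ε) * ∑ i, ((u + -z) i) ^ 2) :
    |(A *ᵥ u) ⬝ᵥ (A *ᵥ z) - u ⬝ᵥ z| ≤ ε / 2 * (∑ i, u i ^ 2 + ∑ i, z i ^ 2) := by
  have key : ∀ {l : ℕ} (x y : Fin l → ℝ),
      ∑ i, ((x + y) i) ^ 2 = ∑ i, x i ^ 2 + 2 * (x ⬝ᵥ y) + ∑ i, y i ^ 2 := by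
    intro l x y
    simp only [dotProduct, Pi.add_apply, Finset.mul_sum, ← Finset.sum_add_distrib]
    exact Finset.sum_congr rfl fun i _ => by ring
  rw [Matrix.mulVec_add, key, key] at hadd hsub
  simp only [Matrix.mulVec_neg, dotProduct_neg, Pi.neg_apply, neg_sq] at hsub
  rw [abs_le]
  constructor <;> linarith [hadd.1, hadd.2, hsub.1, hsub.2]

/-- Cauchy-Schwarz for the eigenvalues of `Aᵀ * A`, of which at most `m` are nonzero. -/
theorem sq_trace_gram_le {m n : ℕ} (A : Matrix (Fin m) (Fin n) ℝ) :
    (∑ i, (Aᵀ * A) i i) ^ 2 ≤ m * ∑ i, ∑ j, (Aᵀ * A) i j ^ 2 := by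
  have h1 : ∑ i, (Aᵀ * A) i i = ∑ a, (A * Aᵀ) a a := Matrix.trace_mul_comm Aᵀ A
  have hsq : ∀ {l : ℕ} (M : Matrix (Fin l) (Fin l) ℝ), Mᵀ = M →
      ∑ i, ∑ j, M i j ^ 2 = (M * M).trace := by
    intro l M hM
    simp only [Matrix.trace, Matrix.diag, Matrix.mul_apply]
    refine Finset.sum_congr rfl fun i _ => Finset.sum_congr rfl fun j _ => ?_
    rw [sq]
    congr 1
    exact congrFun (congrFun hM j) i
  have h2 : ∑ i, ∑ j, (Aᵀ * A) i j ^ 2 = ∑ a, ∑ b, (A * Aᵀ) a b ^ 2 := by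
    rw [hsq _ (by simp), hsq _ (by simp), Matrix.mul_assoc, Matrix.trace_mul_comm]
    simp only [Matrix.mul_assoc]
  rw [h1, h2]
  calc (∑ a, (A * Aᵀ) a a) ^ 2 ≤ m * ∑ a, (A * Aᵀ) a a ^ 2 := by
        simpa using sq_sum_le_card_mul_sum_sq (s := Finset.univ) (f := fun a => (A * Aᵀ) a a)
    _ ≤ _ := by
        gcongr with a
        exact Finset.single_le_sum (f := fun b => (A * Aᵀ) a b ^ 2)
          (fun _ _ => sq_nonneg _) (Finset.mem_univ a)

/-- The coordinates `j` with `j / k = q`. -/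
def block (n k q : ℕ) : Finset (Fin n) := Finset.univ.filter fun j => (j : ℕ) / k = q

theorem card_block_le {n k : ℕ} (hk : 0 < k) (q : ℕ) : (block n k q).card ≤ k := by
  rw [← Finset.card_range k]
  refine Finset.card_le_card_of_injOn (fun j => (j : ℕ) % k)
    (fun j _ => by simpa using Nat.mod_lt _ hk) ?_
  intro a ha b hb hab
  have ha' : (a : ℕ) / k = q := by simpa [block] using ha
  have hb' : (b : ℕ) / k = q := by simpa [block] using hb
  have hab' : (a : ℕ) % k = b % k := hab
  apply Fin.ext
  rw [← Nat.div_add_mod (a : ℕ) k, ← Nat.div_add_mod (b : ℕ) k, ha', hb', hab']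

/-- The indices of the nonempty blocks. -/
def blockIndices (n k : ℕ) : Finset ℕ := Finset.univ.image fun j : Fin n => (j : ℕ) / k

theorem card_blockIndices_le (n k : ℕ) : (blockIndices n k).card ≤ n :=
  Finset.card_image_le.trans (by simp)

theorem card_blockIndices_le_div_add_one (n k : ℕ) : (blockIndices n k).card ≤ n / k + 1 := by
  rw [← Finset.card_range (n / k + 1)]
  refine Finset.card_le_card fun q hq => ?_
  obtain ⟨j, -, rfl⟩ := Finset.mem_image.1 hq
  exact Finset.mem_range.2 (Nat.lt_succ_of_le (Nat.div_le_div_right j.2.le))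

/-- The hard vectors for norm preservation. -/
noncomputable def hardSet (n k : ℕ) : Finset (Fin n → ℝ) :=
  (Finset.univ.image fun i : Fin n => Pi.single i (1 : ℝ)) ∪
    ((Finset.univ : Finset (Fin n)) ×ˢ blockIndices n k).biUnion fun p =>
      (intNet (block n k p.2) k).image fun z =>
        Pi.single p.1 (2 * √(k : ℝ)) + fun j => (z j : ℝ)

theorem card_hardSet_le {n k : ℕ} (hk : 0 < k) (hkn : 48 ^ k ≤ n) :
    (hardSet n k).card ≤ n ^ 3 + n := by
  refine (Finset.card_union_le _ _).trans ?_
  rw [add_comm]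
  refine add_le_add ?_ (Finset.card_image_le.trans (by simp))
  refine (Finset.card_biUnion_le_card_mul _ _ n fun p _ => ?_).trans ?_
  · exact Finset.card_image_le.trans ((card_intNet_le _ (card_block_le hk _)).trans hkn)
  · rw [Finset.card_product, Finset.card_univ, Fintype.card_fin]
    calc n * (blockIndices n k).card * n ≤ n * n * n := by
          gcongr
          exact card_blockIndices_le n k
      _ = n ^ 3 := by ring

theorem lower_bound_of_preserves_hardSet {m n k : ℕ} (hk : 0 < k) (hkn : k ≤ n) {ε : ℝ}
    (hε : 0 < ε) (hε' : ε < 1 / 2) (A : Matrix (Fin m) (Fin n) ℝ)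
    (hA : ∀ v ∈ hardSet n k,
      (1 - ε) * (∑ i, (v i) ^ 2) ≤ (∑ i, (A.mulVec v i) ^ 2) ∧
      (∑ i, (A.mulVec v i) ^ 2) ≤ (1 + ε) * (∑ i, (v i) ^ 2))
    (hm : 16 * (m : ℝ) ≤ n) : (k : ℝ) ≤ 128 * ε ^ 2 * m := by
  have hk' : (0 : ℝ) < k := by exact_mod_cast hk
  have hn' : (0 : ℝ) < n := by exact_mod_cast hk.trans_le hkn
  set G := Aᵀ * A with hG
  have hblock : ∀ i, ∀ q ∈ blockIndices n k,
      ∑ j ∈ block n k q, (G - 1) i j ^ 2 ≤ 4 * ε ^ 2 := by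
    intro i q hq
    obtain ⟨z, hz, hcor⟩ :=
      exists_mem_intNet_correlated (block n k q) (card_block_le hk q) fun j => (G - 1) i j
    have hmem : ∀ y ∈ intNet (block n k q) k,
        Pi.single i (2 * √(k : ℝ)) + (fun j => (y j : ℝ)) ∈ hardSet n k := fun y hy =>
      Finset.mem_union_right _ (Finset.mem_biUnion.2
        ⟨(i, q), by simp [hq], Finset.mem_image_of_mem _ hy⟩)
    have hneg : (fun j => (((-z) j : ℤ) : ℝ)) = -fun j => (z j : ℝ) := by
      ext j
      simp
    have h := abs_dotProduct_mulVec_sub_le A _ _ (hA _ (hmem z hz))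
      (by simpa only [hneg] using hA _ (hmem _ (neg_mem_intNet hz)))
    have hu : ∑ j, (Pi.single i (2 * √(k : ℝ)) : Fin n → ℝ) j ^ 2 = 4 * k := by
      rw [Finset.sum_eq_single i]
      · rw [Pi.single_eq_same, mul_pow, Real.sq_sqrt hk'.le]
        norm_num
      · intro j _ hj
        simp [hj]
      · simp
    have hdot : (A *ᵥ Pi.single i (2 * √(k : ℝ))) ⬝ᵥ (A *ᵥ fun j => (z j : ℝ)) -
        (Pi.single i (2 * √(k : ℝ)) : Fin n → ℝ) ⬝ᵥ (fun j => (z j : ℝ)) =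
        2 * √(k : ℝ) * ∑ j, (G - 1) i j * z j := by
      have h1 : (A *ᵥ Pi.single i (2 * √(k : ℝ))) ⬝ᵥ (A *ᵥ fun j => (z j : ℝ)) =
          Pi.single i (2 * √(k : ℝ)) ⬝ᵥ (G *ᵥ fun j => (z j : ℝ)) := by
        rw [hG, ← Matrix.mulVec_mulVec, Matrix.dotProduct_mulVec, Matrix.dotProduct_mulVec,
          Matrix.vecMul_transpose, Matrix.dotProduct_mulVec]
      rw [h1, ← dotProduct_sub, single_dotProduct]
      congr 1
      have h2 : (G *ᵥ fun j => (z j : ℝ)) - (fun j => (z j : ℝ)) =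
          (G - 1) *ᵥ fun j => (z j : ℝ) := by
        rw [Matrix.sub_mulVec, Matrix.one_mulVec]
      rw [h2]
      rfl
    rw [hdot, hu] at h
    have hz2 := sum_sq_le_of_mem_intNet hz
    have h3 : |2 * √(k : ℝ) * ∑ j, (G - 1) i j * z j| ≤ 4 * ε * k := by
      refine h.trans ?_
      nlinarith
    have h4 := pow_le_pow_left₀ (abs_nonneg _) h3 2
    rw [sq_abs, mul_pow, mul_pow, Real.sq_sqrt hk'.le] at h4
    have h5 : (4 * (k : ℝ) ^ 2) * ∑ j ∈ block n k q, (G - 1) i j ^ 2 ≤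
        (4 * (k : ℝ) ^ 2) * (4 * ε ^ 2) := by
      nlinarith [mul_le_mul_of_nonneg_left hcor (by positivity : (0 : ℝ) ≤ 4 * k)]
    exact le_of_mul_le_mul_left h5 (by positivity)
  have hup : k * ∑ i, ∑ j, (G - 1) i j ^ 2 ≤ 8 * ε ^ 2 * n ^ 2 := by
    have hcard : (k : ℝ) * (blockIndices n k).card ≤ 2 * n := by
      have h1 : k * (blockIndices n k).card ≤ 2 * n := by
        calc k * (blockIndices n k).card ≤ k * (n / k + 1) :=
              Nat.mul_le_mul_left _ (card_blockIndices_le_div_add_one n k)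
          _ = k * (n / k) + k := by ring
          _ ≤ n + n := add_le_add (Nat.mul_div_le n k) hkn
          _ = 2 * n := by ring
      exact_mod_cast h1
    have hrow : ∀ i, ∑ j, (G - 1) i j ^ 2 ≤ (blockIndices n k).card * (4 * ε ^ 2) := by
      intro i
      rw [← Finset.sum_fiberwise_of_maps_to (s := Finset.univ) (t := blockIndices n k)
        (g := fun j : Fin n => (j : ℕ) / k) (fun j hj => Finset.mem_image_of_mem _ hj),
        ← nsmul_eq_mul]
      exact Finset.sum_le_card_nsmul _ _ _ (hblock i)
    have hall : ∑ i, ∑ j, (G - 1) i j ^ 2 ≤ n * ((blockIndices n k).card * (4 * ε ^ 2)) := by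
      simpa using Finset.sum_le_card_nsmul Finset.univ _ _ fun i _ => hrow i
    calc k * ∑ i, ∑ j, (G - 1) i j ^ 2
        ≤ k * (n * ((blockIndices n k).card * (4 * ε ^ 2))) := by gcongr
      _ = (k * (blockIndices n k).card) * (4 * ε ^ 2 * n) := by ring
      _ ≤ (2 * n) * (4 * ε ^ 2 * n) := by gcongr
      _ = _ := by ring
  have htrace : (n : ℝ) / 2 ≤ ∑ i, G i i := by
    have hdiag : ∀ i, (1 / 2 : ℝ) ≤ G i i := by
      intro i
      have h := (hA (Pi.single i 1)
        (Finset.mem_union_left _ (Finset.mem_image_of_mem _ (Finset.mem_univ i)))).1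
      have h1 : ∑ j, (Pi.single i (1 : ℝ) : Fin n → ℝ) j ^ 2 = 1 := by
        rw [Finset.sum_eq_single i] <;> simp +contextual
      have h2 : ∑ a, (A *ᵥ Pi.single i 1) a ^ 2 = G i i := by
        simp only [hG, Matrix.mul_apply, Matrix.mulVec_single_one, Matrix.transpose_apply,
          Matrix.col_apply, sq]
      rw [h1, h2] at h
      linarith
    calc (n : ℝ) / 2 = ∑ _i : Fin n, (1 / 2 : ℝ) := by simp; ring
      _ ≤ _ := Finset.sum_le_sum fun i _ => hdiag i
  have hcs := sq_trace_gram_le A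
  have hGB : ∑ i, ∑ j, G i j ^ 2 ≤ 2 * ∑ i, ∑ j, (G - 1) i j ^ 2 + 2 * n := by
    have hone : ∑ i : Fin n, ∑ j, (1 : Matrix (Fin n) (Fin n) ℝ) i j ^ 2 = n := by
      simp [Matrix.one_apply]
    rw [← hone]
    simp only [Finset.mul_sum, ← Finset.sum_add_distrib]
    refine Finset.sum_le_sum fun i _ => Finset.sum_le_sum fun j _ => ?_
    rw [Matrix.sub_apply]
    nlinarith [sq_nonneg (G i j - 2 * (1 : Matrix (Fin n) (Fin n) ℝ) i j)]
  set F := ∑ i, ∑ j, (G - 1) i j ^ 2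
  have hm0 : (0 : ℝ) ≤ m := Nat.cast_nonneg m
  have h1 : (n : ℝ) ^ 2 / 4 ≤ m * (2 * F + 2 * n) := by
    calc (n : ℝ) ^ 2 / 4 = (n / 2 : ℝ) ^ 2 := by ring
      _ ≤ (∑ i, G i i) ^ 2 := pow_le_pow_left₀ (by positivity) htrace 2
      _ ≤ m * ∑ i, ∑ j, G i j ^ 2 := hcs
      _ ≤ _ := by gcongr
  have h2 : (n : ℝ) ^ 2 ≤ 16 * m * F := by nlinarith
  have h3 : (n : ℝ) ^ 2 * k ≤ n ^ 2 * (128 * ε ^ 2 * m) := by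
    nlinarith [mul_le_mul_of_nonneg_right h2 hk'.le,
      mul_le_mul_of_nonneg_left hup (by positivity : (0 : ℝ) ≤ 16 * m)]
  exact le_of_mul_le_mul_left h3 (by positivity)

theorem log_le_ten_mul_natLog {n : ℕ} (hn : 48 ≤ n) :
    Real.log n ≤ 10 * (Nat.log 48 n : ℝ) := by
  have hk : 1 ≤ Nat.log 48 n := Nat.log_pos (by norm_num) hn
  have h1 : (n : ℝ) ≤ 48 ^ (Nat.log 48 n + 1) := by
    exact_mod_cast (Nat.lt_pow_succ_log_self (by norm_num : 1 < 48) n).le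
  have h48 : Real.log 48 ≤ 5 := by
    calc Real.log 48 ≤ Real.log (2 ^ 6 : ℝ) := Real.log_le_log (by norm_num) (by norm_num)
      _ = 6 * Real.log 2 := by rw [Real.log_pow]; norm_num
      _ ≤ 5 := by linarith [Real.log_two_lt_d9]
  have h2 := Real.log_le_log (by positivity) h1
  rw [Real.log_pow] at h2
  push_cast at h2
  have hk' : (1 : ℝ) ≤ (Nat.log 48 n : ℝ) := by exact_mod_cast hk
  nlinarith

/-- For any integer `n > 1` and any `0 < ε < 1/2`, there exists a universal
constant `c > 0` and a set `V ⊆ ℝ^n` of exactly `n³ + n` vectors such that for any positive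
integer `m` and any matrix `A ∈ ℝ^{m×n}`, if `(1−ε)‖v‖₂² ≤ ‖Av‖₂² ≤ (1+ε)‖v‖₂²` for every
`v ∈ V`, then `m ≥ c · min{n, ε⁻² ln n}`. The constant `c` is universal (independent of
`n, ε, m, A, V`), hence quantified outermost. -/
theorem stmt0 :
    ∃ c : ℝ, 0 < c ∧
      ∀ n : ℕ, 1 < n → ∀ ε : ℝ, 0 < ε → ε < 1/2 →
        ∃ V : Finset (Fin n → ℝ), V.card = n^3 + n ∧
          ∀ m : ℕ, 0 < m → ∀ A : Matrix (Fin m) (Fin n) ℝ,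
            (∀ v ∈ V,
              (1 - ε) * (∑ i, (v i)^2) ≤ (∑ i, (A.mulVec v i)^2) ∧
              (∑ i, (A.mulVec v i)^2) ≤ (1 + ε) * (∑ i, (v i)^2)) →
            c * min (n : ℝ) (ε⁻¹^2 * Real.log n) ≤ (m : ℝ) := by
  refine ⟨1 / 1280, by norm_num, fun n hn ε hε hε' => ?_⟩
  have : Nonempty (Fin n) := ⟨⟨0, by omega⟩⟩
  have : Infinite (Fin n → ℝ) := inferInstance
  rcases lt_or_ge n 48 with hsmall | hlarge
  · obtain ⟨V, hV⟩ := Infinite.exists_subset_card_eq (Fin n → ℝ) (n ^ 3 + n)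
    refine ⟨V, hV, fun m hm A _ => ?_⟩
    have hm' : (1 : ℝ) ≤ m := by exact_mod_cast hm
    have hn' : (n : ℝ) ≤ 48 := by exact_mod_cast hsmall.le
    linarith [min_le_left (n : ℝ) (ε⁻¹ ^ 2 * Real.log n)]
  · set k := Nat.log 48 n with hk
    have hk0 : 0 < k := Nat.log_pos (by norm_num) hlarge
    have hpow : 48 ^ k ≤ n := Nat.pow_log_le_self 48 (by omega)
    have hkn : k ≤ n := Nat.log_le_self 48 n
    obtain ⟨V, hsub, hV⟩ :=
      Infinite.exists_superset_card_eq (hardSet n k) (n ^ 3 + n) (card_hardSet_le hk0 hpow)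
    refine ⟨V, hV, fun m hm A hA => ?_⟩
    rcases le_total (16 * (m : ℝ)) n with hmn | hmn
    · have h1 := lower_bound_of_preserves_hardSet hk0 hkn hε hε' A
        (fun v hv => hA v (hsub hv)) hmn
      have h2 : Real.log n ≤ 1280 * m * ε ^ 2 := by
        nlinarith [log_le_ten_mul_natLog hlarge]
      have h3 : ε⁻¹ ^ 2 * Real.log n ≤ 1280 * m := by
        rw [inv_pow, inv_mul_le_iff₀ (by positivity)]
        linarith
      linarith [min_le_right (n : ℝ) (ε⁻¹ ^ 2 * Real.log n)]
    · have hm' : (0 : ℝ) ≤ m := Nat.cast_nonneg m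
      linarith [min_le_left (n : ℝ) (ε⁻¹ ^ 2 * Real.log n)]
end

section
/- There exists a universal constant C > 0 such that for any finite subset X of ℝ^n with |X| = N ≥ 2 and any 0 < ε < 1/2, there exist a positive integer m ≤ C · ε^{−2} · ln N and a map f : X → ℝ^m such that for all x, y ∈ X, (1−ε)‖x−y‖₂² ≤ ‖f(x)−f(y)‖₂² ≤ (1+ε)‖x−y‖₂². -/
open Matrix

open MeasureTheory ProbabilityTheory

lemma exp_neg_add_sq_le_one_sub {x : ℝ} (hx : |x| ≤ 1 / 2) : Real.exp (-(x + x ^ 2)) ≤ 1 - x := by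
  obtain ⟨hl, hu⟩ := abs_le.mp hx
  rw [Real.exp_neg, inv_le_comm₀ (Real.exp_pos _) (by linarith),
    inv_le_iff_one_le_mul₀ (by linarith)]
  rcases le_total 0 x with h | h
  · have h2 := Real.quadratic_le_exp_of_nonneg (x := x + x ^ 2) (by positivity)
    calc (1 : ℝ) ≤ (1 + (x + x ^ 2) + (x + x ^ 2) ^ 2 / 2) * (1 - x) := by
          have h3 : 0 ≤ x ^ 2 * ((1 - x) * (1 + x) ^ 2 - 2 * x) := by
            apply mul_nonneg (sq_nonneg x)
            nlinarith [mul_nonneg h h, mul_nonneg h (sub_nonneg.mpr hu)]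
          linarith
      _ ≤ _ := mul_le_mul_of_nonneg_right h2 (by linarith)
  · have h2 := Real.add_one_le_exp (x + x ^ 2)
    calc (1 : ℝ) ≤ (x + x ^ 2 + 1) * (1 - x) := by
          nlinarith [mul_nonneg (neg_nonneg.mpr h) (sq_nonneg x)]
      _ ≤ _ := mul_le_mul_of_nonneg_right h2 (by linarith)

lemma gaussianPDFReal_smul_exp_sq_sub_one (t x : ℝ) :
    gaussianPDFReal 0 1 x • Real.exp (t * (x ^ 2 - 1)) =
      (√(2 * Real.pi))⁻¹ * Real.exp (-t) * Real.exp (-(1 / 2 - t) * x ^ 2) := by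
  simp only [gaussianPDFReal, smul_eq_mul, NNReal.coe_one, mul_one, sub_zero, mul_assoc]
  rw [← Real.exp_add, ← Real.exp_add]
  congr 2
  ring

lemma integrable_exp_sq_sub_one_gaussianReal {t : ℝ} (ht : t < 1 / 2) :
    Integrable (fun x : ℝ ↦ Real.exp (t * (x ^ 2 - 1))) (gaussianReal 0 1) := by
  rw [gaussianReal_of_var_ne_zero _ one_ne_zero,
    integrable_withDensity_iff_integrable_smul' (measurable_gaussianPDF 0 1)
      (Filter.Eventually.of_forall fun _ ↦ gaussianPDF_lt_top)]
  simp_rw [toReal_gaussianPDF, gaussianPDFReal_smul_exp_sq_sub_one]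
  exact (integrable_exp_neg_mul_sq (by linarith)).const_mul _

lemma integral_exp_sq_sub_one_gaussianReal_le {t : ℝ} (ht : |t| ≤ 1 / 4) :
    ∫ x : ℝ, Real.exp (t * (x ^ 2 - 1)) ∂gaussianReal 0 1 ≤ Real.exp (2 * t ^ 2) := by
  have hpos : 0 < 1 - 2 * t := by linarith [(abs_le.mp ht).2]
  have hexp : Real.exp (-(t + 2 * t ^ 2)) ≤ √(1 - 2 * t) := by
    apply Real.le_sqrt_of_sq_le
    rw [← Real.exp_nat_mul]
    convert exp_neg_add_sq_le_one_sub (x := 2 * t) (by rw [abs_mul, abs_two]; linarith) using 2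
    push_cast
    ring
  rw [integral_gaussianReal_eq_integral_smul one_ne_zero]
  simp_rw [gaussianPDFReal_smul_exp_sq_sub_one]
  rw [integral_const_mul, integral_gaussian]
  have hsqrt : √(Real.pi / (1 / 2 - t)) = √(2 * Real.pi) / √(1 - 2 * t) := by
    rw [← Real.sqrt_div (by positivity)]
    congr 1
    have : 1 / 2 - t ≠ 0 := by linarith
    field_simp
  have hne : √(2 * Real.pi) ≠ 0 := by positivity
  calc (√(2 * Real.pi))⁻¹ * Real.exp (-t) * √(Real.pi / (1 / 2 - t))
      = Real.exp (-t) / √(1 - 2 * t) := by rw [hsqrt]; field_simp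
    _ ≤ Real.exp (-t) / Real.exp (-(t + 2 * t ^ 2)) := by gcongr
    _ = Real.exp (2 * t ^ 2) := by rw [← Real.exp_sub]; congr 1; ring

section InnerProduct

variable {E : Type*} [NormedAddCommGroup E] [InnerProductSpace ℝ E] [FiniteDimensional ℝ E]
  [MeasurableSpace E] [BorelSpace E]

lemma stdGaussian_map_inner {u : E} (hu : ‖u‖ = 1) :
    (stdGaussian E).map (fun g ↦ inner ℝ u g) = gaussianReal 0 1 := by
  have h := IsGaussian.map_eq_gaussianReal (μ := stdGaussian E) (innerSL ℝ u)
  rw [integral_strongDual_stdGaussian, variance_dual_stdGaussian, innerSL_apply_norm, hu] at h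
  simpa using h

lemma integrable_exp_inner_sq_sub_one {u : E} (hu : ‖u‖ = 1) {t : ℝ} (ht : t < 1 / 2) :
    Integrable (fun g ↦ Real.exp (t * (inner ℝ u g ^ 2 - 1))) (stdGaussian E) := by
  have h := integrable_exp_sq_sub_one_gaussianReal ht
  rw [← stdGaussian_map_inner hu] at h
  exact h.comp_measurable (by fun_prop)

lemma integral_exp_inner_sq_sub_one_le {u : E} (hu : ‖u‖ = 1) {t : ℝ} (ht : |t| ≤ 1 / 4) :
    ∫ g, Real.exp (t * (inner ℝ u g ^ 2 - 1)) ∂stdGaussian E ≤ Real.exp (2 * t ^ 2) := by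
  have h := integral_exp_sq_sub_one_gaussianReal_le ht
  rwa [← stdGaussian_map_inner hu, integral_map (by fun_prop) (by fun_prop)] at h

lemma integrable_exp_sum_inner_sq_sub_one {u : E} (hu : ‖u‖ = 1) {t : ℝ} (ht : t < 1 / 2) (m : ℕ) :
    Integrable (fun G : Fin m → E ↦ Real.exp (t * ∑ i, (inner ℝ u (G i) ^ 2 - 1)))
      (Measure.pi fun _ ↦ stdGaussian E) := by
  simp_rw [Finset.mul_sum, Real.exp_sum]
  exact Integrable.fintype_prod (f := fun _ g ↦ Real.exp (t * (inner ℝ u g ^ 2 - 1)))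
    fun _ ↦ integrable_exp_inner_sq_sub_one hu ht

lemma integral_exp_sum_inner_sq_sub_one_le {u : E} (hu : ‖u‖ = 1) {t : ℝ} (ht : |t| ≤ 1 / 4)
    (m : ℕ) :
    ∫ G : Fin m → E, Real.exp (t * ∑ i, (inner ℝ u (G i) ^ 2 - 1))
      ∂(Measure.pi fun _ ↦ stdGaussian E) ≤ Real.exp (m * (2 * t ^ 2)) := by
  simp_rw [Finset.mul_sum, Real.exp_sum]
  rw [integral_fintype_prod_eq_pow (fun g ↦ Real.exp (t * (inner ℝ u g ^ 2 - 1))), Fintype.card_fin,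
    Real.exp_nat_mul]
  exact pow_le_pow_left₀ (integral_nonneg fun _ ↦ (Real.exp_pos _).le)
    (integral_exp_inner_sq_sub_one_le hu ht) m

/-- Some `m` vectors `G i` make `∑ i, ⟪u, G i⟫ ^ 2` close to `m` for all unit vectors `u` in a
given finite set, as soon as `m` is large compared with the logarithm of its size. -/
lemma exists_forall_abs_sum_inner_sq_sub_one_lt (U : Finset E) (hU : ∀ u ∈ U, ‖u‖ = 1) {ε : ℝ}
    (hε : 0 < ε) (hε1 : ε ≤ 1) {m : ℕ} (hm : 2 * (U.card : ℝ) < Real.exp (m * (ε ^ 2 / 8))) :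
    ∃ G : Fin m → E, ∀ u ∈ U, |∑ i, (inner ℝ u (G i) ^ 2 - 1)| < ε * m := by
  have ht : |ε / 4| ≤ 1 / 4 := by rw [abs_of_pos (by positivity)]; linarith
  have ht' : |-(ε / 4)| ≤ 1 / 4 := by rwa [abs_neg]
  let S (u : E) (G : Fin m → E) : ℝ := ∑ i, (inner ℝ u (G i) ^ 2 - 1)
  let F (G : Fin m → E) : ℝ :=
    ∑ u ∈ U, (Real.exp (ε / 4 * S u G) + Real.exp (-(ε / 4) * S u G))
  have hpos (u : E) (hu : u ∈ U) := integrable_exp_sum_inner_sq_sub_one (hU u hu)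
    (t := ε / 4) (by linarith) m
  have hneg (u : E) (hu : u ∈ U) := integrable_exp_sum_inner_sq_sub_one (hU u hu)
    (t := -(ε / 4)) (by linarith) m
  have hF : Integrable F (Measure.pi fun _ ↦ stdGaussian E) :=
    integrable_finsetSum _ fun u hu ↦ (hpos u hu).add (hneg u hu)
  have hFle : ∫ G, F G ∂(Measure.pi fun _ ↦ stdGaussian E) < Real.exp (m * (ε ^ 2 / 4)) := by
    calc ∫ G, F G ∂(Measure.pi fun _ ↦ stdGaussian E)
        ≤ ∑ u ∈ U, 2 * Real.exp (m * (ε ^ 2 / 8)) := by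
          refine (integral_finsetSum _ fun u hu ↦ (hpos u hu).add (hneg u hu)).trans_le
            (Finset.sum_le_sum fun u hu ↦ (integral_add (hpos u hu) (hneg u hu)).trans_le ?_)
          have h := integral_exp_sum_inner_sq_sub_one_le (hU u hu) ht m
          have h' := integral_exp_sum_inner_sq_sub_one_le (hU u hu) ht' m
          rw [show 2 * (ε / 4) ^ 2 = ε ^ 2 / 8 by ring] at h
          rw [show 2 * (-(ε / 4)) ^ 2 = ε ^ 2 / 8 by ring] at h'
          linarith
      _ = 2 * U.card * Real.exp (m * (ε ^ 2 / 8)) := by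
          rw [Finset.sum_const, nsmul_eq_mul]; ring
      _ < Real.exp (m * (ε ^ 2 / 8)) * Real.exp (m * (ε ^ 2 / 8)) := by gcongr
      _ = Real.exp (m * (ε ^ 2 / 4)) := by rw [← Real.exp_add]; congr 1; ring
  obtain ⟨G, hG⟩ := exists_le_integral hF
  refine ⟨G, fun u hu ↦ ?_⟩
  have hsum := (Finset.single_le_sum (fun v _ ↦ by positivity) hu).trans_lt (hG.trans_lt hFle)
  have h := Real.exp_lt_exp.mp (lt_of_le_of_lt (le_add_of_nonneg_right (Real.exp_pos _).le) hsum)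
  have h' := Real.exp_lt_exp.mp (lt_of_le_of_lt (le_add_of_nonneg_left (Real.exp_pos _).le) hsum)
  exact abs_lt.mpr ⟨by change _ < S u G; nlinarith, by change S u G < _; nlinarith⟩

/-- The Johnson–Lindenstrauss lemma in an inner product space, with an explicit condition on the
target dimension. -/
lemma exists_forall_abs_sum_sub_sq_sub_le (X : Finset E) {ε : ℝ} (hε : 0 < ε) (hε1 : ε ≤ 1)
    {m : ℕ} (hm0 : 0 < m) (hm : 2 * (X.card : ℝ) ^ 2 < Real.exp (m * (ε ^ 2 / 8))) :
    ∃ f : E → Fin m → ℝ, ∀ x ∈ X, ∀ y ∈ X,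
      |∑ i, (f x i - f y i) ^ 2 - ‖x - y‖ ^ 2| ≤ ε * ‖x - y‖ ^ 2 := by
  classical
  let U : Finset E := (X.offDiag).image fun p ↦ ‖p.1 - p.2‖⁻¹ • (p.1 - p.2)
  have hU : ∀ u ∈ U, ‖u‖ = 1 := by
    intro u hu
    obtain ⟨p, hp, rfl⟩ := Finset.mem_image.mp hu
    exact norm_smul_inv_norm (𝕜 := ℝ) (sub_ne_zero.mpr (Finset.mem_offDiag.mp hp).2.2)
  have hcard : (U.card : ℝ) ≤ (X.card : ℝ) ^ 2 := by
    have h : U.card ≤ X.card ^ 2 := by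
      refine Finset.card_image_le.trans ?_
      rw [Finset.offDiag_card, sq]
      exact Nat.sub_le _ _
    exact_mod_cast h
  obtain ⟨G, hG⟩ := exists_forall_abs_sum_inner_sq_sub_one_lt U hU hε hε1
    (m := m) (by linarith)
  have hm' : (0 : ℝ) < m := by exact_mod_cast hm0
  refine ⟨fun x i ↦ inner ℝ x (G i) / √m, fun x hx y hy ↦ ?_⟩
  rcases eq_or_ne x y with rfl | hxy
  · simp
  have hr : 0 < ‖x - y‖ := norm_pos_iff.mpr (sub_ne_zero.mpr hxy)
  have h := hG (‖x - y‖⁻¹ • (x - y))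
    (Finset.mem_image.mpr ⟨(x, y), Finset.mem_offDiag.mpr ⟨hx, hy, hxy⟩, rfl⟩)
  have hsum : ∑ i, (inner ℝ x (G i) / √m - inner ℝ y (G i) / √m) ^ 2 - ‖x - y‖ ^ 2 =
      ‖x - y‖ ^ 2 / m * ∑ i, (inner ℝ (‖x - y‖⁻¹ • (x - y)) (G i) ^ 2 - 1) := by
    simp_rw [← sub_div, ← inner_sub_left, div_pow, Real.sq_sqrt hm'.le, real_inner_smul_left]
    rw [Finset.sum_sub_distrib, ← Finset.sum_div]
    simp_rw [mul_pow]
    rw [← Finset.mul_sum]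
    simp only [Finset.sum_const, Finset.card_univ, Fintype.card_fin, nsmul_eq_mul, mul_one]
    field_simp
  rw [hsum, abs_mul, abs_of_pos (by positivity)]
  calc ‖x - y‖ ^ 2 / m * |∑ i, (inner ℝ (‖x - y‖⁻¹ • (x - y)) (G i) ^ 2 - 1)|
      ≤ ‖x - y‖ ^ 2 / m * (ε * m) := by gcongr
    _ = ε * ‖x - y‖ ^ 2 := by field_simp

end InnerProduct

/-- Johnson–Lindenstrauss lemma: There is a universal constant `C > 0` such
that for any finite `X ⊆ ℝ^n` with `|X| = N ≥ 2` and any `0 < ε < 1/2`, there exist a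
positive integer `m ≤ C ε⁻² ln N` and a map `f : X → ℝ^m` such that for all `x, y ∈ X`,
`(1−ε)‖x−y‖₂² ≤ ‖f(x)−f(y)‖₂² ≤ (1+ε)‖x−y‖₂²`. -/
theorem stmt1 :
    ∃ C : ℝ, 0 < C ∧
      ∀ (n N : ℕ) (X : Finset (Fin n → ℝ)), X.card = N → 2 ≤ N →
        ∀ ε : ℝ, 0 < ε → ε < 1/2 →
          ∃ m : ℕ, 0 < m ∧ (m : ℝ) ≤ C * ε⁻¹^2 * Real.log N ∧
            ∃ f : (Fin n → ℝ) → (Fin m → ℝ),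
              ∀ x ∈ X, ∀ y ∈ X,
                (1 - ε) * (∑ i, (x i - y i)^2) ≤ (∑ i, (f x i - f y i)^2) ∧
                (∑ i, (f x i - f y i)^2) ≤ (1 + ε) * (∑ i, (x i - y i)^2) := by
  classical
  refine ⟨25, by norm_num, fun n N X hN hN2 ε hε hε2 ↦ ?_⟩
  have hN2' : (2 : ℝ) ≤ N := by exact_mod_cast hN2
  have hlog : 1 / 2 ≤ Real.log N := by
    linarith [Real.log_two_gt_d9, Real.log_le_log two_pos hN2']
  have hinv : 2 ≤ ε⁻¹ := by rw [le_inv_comm₀ two_pos hε]; linarith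
  have hK : 1 ≤ ε⁻¹ ^ 2 * Real.log N := by nlinarith
  have hlt := Nat.lt_floor_add_one (24 * (ε⁻¹ ^ 2 * Real.log N))
  have hle := Nat.floor_le (show 0 ≤ 24 * (ε⁻¹ ^ 2 * Real.log N) by positivity)
  set m := ⌊24 * (ε⁻¹ ^ 2 * Real.log N)⌋₊ + 1 with hm
  refine ⟨m, Nat.succ_pos _, by rw [hm]; push_cast; linarith, ?_⟩
  let e : (Fin n → ℝ) ↪ EuclideanSpace ℝ (Fin n) := ⟨WithLp.toLp 2, WithLp.toLp_injective 2⟩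
  have hcard : 2 * ((X.map e).card : ℝ) ^ 2 < Real.exp (m * (ε ^ 2 / 8)) := by
    rw [Finset.card_map, hN]
    have hexp : 3 * Real.log N < m * (ε ^ 2 / 8) := by
      calc 3 * Real.log N = 24 * (ε⁻¹ ^ 2 * Real.log N) * (ε ^ 2 / 8) := by field_simp; norm_num
        _ < m * (ε ^ 2 / 8) := by
          apply mul_lt_mul_of_pos_right _ (by positivity)
          rw [hm]
          exact_mod_cast hlt
    calc 2 * (N : ℝ) ^ 2 ≤ N * (N : ℝ) ^ 2 := by gcongr
      _ = Real.exp (3 * Real.log N) := by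
        rw [show (3 : ℝ) = (3 : ℕ) by norm_num, Real.exp_nat_mul, Real.exp_log (by linarith)]; ring
      _ < _ := Real.exp_lt_exp.mpr hexp
  obtain ⟨f, hf⟩ := exists_forall_abs_sum_sub_sq_sub_le (X.map e) hε (by linarith)
    (Nat.succ_pos _) hcard
  refine ⟨fun x ↦ f (e x), fun x hx y hy ↦ ?_⟩
  have h := abs_le.mp (hf _ (Finset.mem_map_of_mem e hx) _ (Finset.mem_map_of_mem e hy))
  have hnorm : ‖e x - e y‖ ^ 2 = ∑ i, (x i - y i) ^ 2 := by
    rw [EuclideanSpace.real_norm_sq_eq]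
    rfl
  rw [hnorm] at h
  constructor <;> linarith [h.1, h.2]
end

section
/- There exist universal constants c₁, δ₀ > 0 such that the following holds. Let d, n be positive integers, let A ∈ ℝ^{d×n} be a matrix, and let g ∈ ℝ^n be a standard gaussian vector. Then for any 0 < δ < δ₀, Pr( |‖A g‖₂² − tr(AᵀA)| ≥ c₁ √(ln(1/δ)) · ‖AᵀA‖_F ) > δ/2. -/
open Matrix MeasureTheory ProbabilityTheory

/-- The Frobenius norm of a real matrix. -/
noncomputable def frobNorm {m n : Type*} [Fintype m] [Fintype n] (A : Matrix m n ℝ) : ℝ :=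
  Real.sqrt (∑ i, ∑ j, (A i j)^2)

lemma map_mulVec_eigenvectorUnitary_pi_gaussianReal {ι : Type*} [Fintype ι] [DecidableEq ι]
    {M : Matrix ι ι ℝ} (hM : M.IsHermitian) :
    (Measure.pi fun _ : ι => gaussianReal 0 1).map
        ((hM.eigenvectorUnitary : Matrix ι ι ℝ).mulVec) =
      Measure.pi fun _ : ι => gaussianReal 0 1 := by
  have h := (map_pi_eq_stdGaussian (ι := ι)).trans
    (stdGaussian_eq_map_pi_orthonormalBasis hM.eigenvectorBasis)
  have h' := congrArg (Measure.map (WithLp.ofLp (p := 2) (V := ι → ℝ))) h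
  rw [Measure.map_map (by fun_prop) (by fun_prop), Measure.map_map (by fun_prop) (by fun_prop)] at h'
  have e1 : (WithLp.ofLp ∘ WithLp.toLp 2 : (ι → ℝ) → ι → ℝ) = id := by ext; simp
  rw [e1, Measure.map_id] at h'
  conv_rhs => rw [h']
  congr 1
  ext x i
  simp [Matrix.mulVec, dotProduct, mul_comm]

lemma sum_mulVec_eigenvectorUnitary_sq {m ι : Type*} [Fintype m] [Fintype ι] [DecidableEq ι]
    (A : Matrix m ι ℝ) (hM : (Aᵀ * A).IsHermitian) (x : ι → ℝ) :
    ∑ i, (A *ᵥ ((hM.eigenvectorUnitary : Matrix ι ι ℝ) *ᵥ x)) i ^ 2 =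
      ∑ i, hM.eigenvalues i * x i ^ 2 := by
  set U : Matrix ι ι ℝ := ↑hM.eigenvectorUnitary with hU
  have hD : Uᵀ * (Aᵀ * A) * U = diagonal hM.eigenvalues := by
    have := hM.conjStarAlgAut_star_eigenvectorUnitary
    simpa [Unitary.conjStarAlgAut_apply, star_eq_conjTranspose, Function.comp_def] using this
  have h1 : ∑ i, (A *ᵥ (U *ᵥ x)) i ^ 2 = (A *ᵥ (U *ᵥ x)) ⬝ᵥ (A *ᵥ (U *ᵥ x)) := by
    simp [dotProduct, sq]
  rw [h1, mulVec_mulVec, dotProduct_mulVec, ← mulVec_transpose, mulVec_mulVec, transpose_mul,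
    show Uᵀ * Aᵀ * (A * U) = diagonal hM.eigenvalues by rw [← hD]; simp only [Matrix.mul_assoc]]
  simp [dotProduct, mulVec_diagonal, sq, mul_assoc]

lemma frobNorm_eq_sqrt_sum_eigenvalues_sq {ι : Type*} [Fintype ι] [DecidableEq ι]
    {M : Matrix ι ι ℝ} (hM : M.IsHermitian) :
    frobNorm M = √(∑ i, hM.eigenvalues i ^ 2) := by
  have h1 : ∑ i, ∑ j, M i j ^ 2 = (Mᵀ * M).trace := by
    simp only [trace, diag, mul_apply, transpose_apply, ← sq]
    exact Finset.sum_comm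
  have hT : Mᵀ = M := by simpa using hM.eq
  have h2 : (M * M).trace = ∑ i, hM.eigenvalues i ^ 2 := by
    conv_lhs => rw [hM.spectral_theorem]
    rw [← map_mul, Unitary.conjStarAlgAut_apply, trace_mul_comm, ← mul_assoc]
    simp [diagonal_mul_diagonal, trace_diagonal, sq]
  rw [frobNorm, h1, hT, h2]

lemma integrable_exp_mul_sq_sub_one_gaussianReal {s : ℝ} (hs : s < 1 / 2) :
    Integrable (fun x : ℝ => Real.exp (s * (x ^ 2 - 1))) (gaussianReal 0 1) := by
  rw [gaussianReal_of_var_ne_zero _ one_ne_zero,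
    integrable_withDensity_iff_integrable_smul' (measurable_gaussianPDF 0 1)
      (ae_of_all _ fun x => gaussianPDF_lt_top)]
  have h := ((integrable_exp_neg_mul_sq (show 0 < 1 / 2 - s by linarith)).const_mul
    (Real.exp (-s) * (√(2 * Real.pi))⁻¹))
  refine h.congr (ae_of_all _ fun x => ?_)
  simp only [toReal_gaussianPDF, gaussianPDFReal, NNReal.coe_one, mul_one, sub_zero, smul_eq_mul]
  rw [mul_right_comm, ← Real.exp_add, mul_comm, mul_assoc, ← Real.exp_add]
  ring_nf

lemma integral_exp_mul_sq_sub_one_gaussianReal (s : ℝ) :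
    ∫ x, Real.exp (s * (x ^ 2 - 1)) ∂(gaussianReal 0 1) = Real.exp (-s) * √(1 / (1 - 2 * s)) := by
  rw [integral_gaussianReal_eq_integral_smul one_ne_zero]
  have h : ∀ x : ℝ, gaussianPDFReal 0 1 x • Real.exp (s * (x ^ 2 - 1)) =
      Real.exp (-s) * (√(2 * Real.pi))⁻¹ * Real.exp (-(1 / 2 - s) * x ^ 2) := fun x => by
    simp only [gaussianPDFReal, NNReal.coe_one, mul_one, sub_zero, smul_eq_mul]
    rw [mul_right_comm (Real.exp (-s)), ← Real.exp_add, mul_comm (Real.exp _), mul_assoc,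
      ← Real.exp_add]
    ring_nf
  simp_rw [h]
  rw [integral_const_mul, integral_gaussian, mul_assoc, ← Real.sqrt_inv, ← Real.sqrt_mul (by positivity)]
  congr 2
  rw [show 1 / 2 - s = (1 - 2 * s) / 2 by ring]
  have := Real.pi_pos
  field_simp

lemma exp_sq_le_integral_exp_mul_sq_sub_one {s : ℝ} (h0 : 0 ≤ s) (hs : s < 1 / 2) :
    Real.exp (s ^ 2) ≤ ∫ x, Real.exp (s * (x ^ 2 - 1)) ∂(gaussianReal 0 1) := by
  have hpos : 0 < 1 - 2 * s := by linarith
  have hlog : 2 * s + (2 * s) ^ 2 / 2 ≤ -Real.log (1 - 2 * s) := by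
    have h := sum_le_hasSum (Finset.range 2) (fun i _ => by positivity)
      (Real.hasSum_pow_div_log_of_abs_lt_one (x := 2 * s) (by rw [abs_lt]; constructor <;> linarith))
    simpa [Finset.sum_range_succ, one_add_one_eq_two] using h
  rw [integral_exp_mul_sq_sub_one_gaussianReal, Real.sqrt_eq_rpow, Real.rpow_def_of_pos (by positivity),
    ← Real.exp_add, Real.exp_le_exp, one_div, Real.log_inv]
  linarith

lemma integral_exp_mul_sq_sub_one_le {s : ℝ} (h0 : 0 ≤ s) (hs : s ≤ 1 / 4) :
    ∫ x, Real.exp (s * (x ^ 2 - 1)) ∂(gaussianReal 0 1) ≤ Real.exp (4 * s ^ 2) := by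
  have hpos : 0 < 1 - 2 * s := by linarith
  have hlog : -Real.log (1 - 2 * s) ≤ 2 * s + 2 * (2 * s) ^ 2 := by
    have h := Real.abs_log_sub_add_sum_range_le (x := 2 * s)
      (by rw [abs_lt]; constructor <;> linarith) 1
    have h' := neg_le_of_abs_le h
    have h2 : |2 * s| ^ (1 + 1) / (1 - |2 * s|) ≤ 2 * (2 * s) ^ 2 := by
      rw [abs_of_nonneg (by positivity), div_le_iff₀ hpos, one_add_one_eq_two]
      nlinarith [mul_nonneg (sq_nonneg (2 * s)) (show 0 ≤ 1 - 4 * s by linarith)]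
    simp only [Finset.sum_range_one] at h'
    norm_num at h' h2 ⊢
    linarith
  rw [integral_exp_mul_sq_sub_one_gaussianReal, Real.sqrt_eq_rpow, Real.rpow_def_of_pos (by positivity),
    ← Real.exp_add, Real.exp_le_exp, one_div, Real.log_inv]
  linarith

lemma le_measureReal_half_integral_le {Ω : Type*} [MeasurableSpace Ω] {P : Measure Ω}
    [IsProbabilityMeasure P] {X : Ω → ℝ} (hm : Measurable X) (hX : Integrable X P)
    (hX2 : Integrable (fun ω => X ω ^ 2) P) (hpos : 0 < ∫ ω, X ω ∂P) {b : ℝ}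
    (hb : ∫ ω, X ω ^ 2 ∂P ≤ b) (hb0 : 0 < b) :
    (∫ ω, X ω ∂P) ^ 2 / (4 * b) ≤ P.real {ω | (∫ ω, X ω ∂P) / 2 ≤ X ω} := by
  set m := ∫ ω, X ω ∂P with hmdef
  set E := {ω | m / 2 ≤ X ω} with hE
  have hEm : MeasurableSet E := measurableSet_le measurable_const hm
  set a := m / (2 * b) with ha
  have ha0 : 0 < a := by positivity
  have hle : ∀ ω, X ω ≤ m / 2 + (a / 2 * X ω ^ 2 + 1 / (2 * a) * E.indicator 1 ω) := by
    intro ω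
    by_cases h : ω ∈ E
    · simp only [Set.indicator_of_mem h, Pi.one_apply]
      have : X ω ≤ a / 2 * X ω ^ 2 + 1 / (2 * a) * 1 := by
        have : a / 2 * X ω ^ 2 + 1 / (2 * a) * 1 - X ω = (a * X ω - 1) ^ 2 / (2 * a) := by
          field_simp; ring
        have : 0 ≤ (a * X ω - 1) ^ 2 / (2 * a) := by positivity
        linarith
      linarith
    · simp only [Set.indicator_of_notMem h]
      have : X ω < m / 2 := not_le.mp h
      nlinarith [sq_nonneg (X ω), mul_nonneg ha0.le (sq_nonneg (X ω))]
  have hI : Integrable (E.indicator (1 : Ω → ℝ)) P := (integrable_const (1 : ℝ)).indicator hEm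
  have h := integral_mono hX ((integrable_const (m / 2)).add
    ((hX2.const_mul (a / 2)).add (hI.const_mul (1 / (2 * a))))) hle
  simp only [Pi.add_apply] at h
  rw [integral_add (integrable_const _) (by exact (hX2.const_mul _).add (hI.const_mul _)),
    integral_add (hX2.const_mul _) (hI.const_mul _), integral_const_mul, integral_const_mul,
    integral_indicator_one hEm, integral_const, ← hmdef] at h
  simp only [probReal_univ, smul_eq_mul, one_mul] at h
  have h1 : a / 2 * ∫ ω, X ω ^ 2 ∂P ≤ m / 4 := by
    calc _ ≤ a / 2 * b := by gcongr
      _ = m / 4 := by rw [ha]; field_simp; ring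
  have h2 : 1 / (2 * a) = b / m := by rw [ha]; field_simp
  rw [h2] at h
  have h3 : m / 4 ≤ b / m * P.real E := by linarith
  rw [div_mul_eq_mul_div, le_div_iff₀ hpos] at h3
  rw [div_le_iff₀ (by positivity)]
  linarith

lemma exp_neg_sq_le_gaussianReal {t : ℝ} (ht : 2 ≤ t) :
    Real.exp (-t ^ 2) ≤ (gaussianReal 0 1).real (Set.Ici (t / 2)) := by
  calc Real.exp (-t ^ 2) ≤ (√(2 * Real.pi))⁻¹ * Real.exp (-t ^ 2 / 2) := by
        have h1 : √(2 * Real.pi) ≤ 3 := by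
          rw [Real.sqrt_le_left (by norm_num)]; linarith [Real.pi_lt_d2]
        have h2 : (3 : ℝ) ≤ Real.exp (t ^ 2 / 2) := by
          nlinarith [Real.add_one_le_exp (t ^ 2 / 2)]
        rw [← div_eq_inv_mul, le_div_iff₀ (by positivity)]
        calc _ ≤ Real.exp (-t ^ 2) * Real.exp (t ^ 2 / 2) := by gcongr; linarith
          _ = _ := by rw [← Real.exp_add]; ring_nf
    _ = ∫ x in Set.Icc (t / 2) (t / 2 + 1), (√(2 * Real.pi))⁻¹ * Real.exp (-t ^ 2 / 2) := by
        simp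
    _ ≤ ∫ x in Set.Icc (t / 2) (t / 2 + 1), gaussianPDFReal 0 1 x := by
        refine setIntegral_mono_on (integrableOn_const (by simp)) (integrable_gaussianPDFReal 0 1).integrableOn
          measurableSet_Icc fun x hx => ?_
        simp only [gaussianPDFReal, NNReal.coe_one, mul_one, sub_zero]
        gcongr
        · linarith [hx.1]
        · linarith [hx.2]
    _ ≤ ∫ x in Set.Ici (t / 2), gaussianPDFReal 0 1 x := by
        refine setIntegral_mono_set (integrable_gaussianPDFReal 0 1).integrableOn
          (ae_of_all _ fun x => gaussianPDFReal_nonneg 0 1 x) ?_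
        exact (Set.Icc_subset_Ici_self).eventuallyLE
    _ = _ := by
        rw [measureReal_def, gaussianReal_apply_eq_integral 0 one_ne_zero, ENNReal.toReal_ofReal]
        exact integral_nonneg fun x => gaussianPDFReal_nonneg 0 1 x

lemma integrable_exp_mul_sum_mul_sq_sub_one {ι : Type*} [Fintype ι] {l : ι → ℝ}
    {s : ℝ} (hs : ∀ i, s * l i < 1 / 2) :
    Integrable (fun x : ι → ℝ => Real.exp (s * ∑ i, l i * (x i ^ 2 - 1)))
      (Measure.pi fun _ : ι => gaussianReal 0 1) := by
  have h := Integrable.fintype_prod (μ := fun _ : ι => gaussianReal 0 1)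
    (f := fun i x => Real.exp (s * l i * (x ^ 2 - 1)))
    fun i => integrable_exp_mul_sq_sub_one_gaussianReal (hs i)
  simpa only [← Real.exp_sum, mul_assoc, ← Finset.mul_sum] using h

lemma integral_exp_mul_sum_mul_sq_sub_one {ι : Type*} [Fintype ι] (l : ι → ℝ) (s : ℝ) :
    ∫ x, Real.exp (s * ∑ i, l i * (x i ^ 2 - 1)) ∂(Measure.pi fun _ : ι => gaussianReal 0 1) =
      ∏ i, ∫ x, Real.exp (s * l i * (x ^ 2 - 1)) ∂(gaussianReal 0 1) := by
  rw [← integral_fintype_prod_eq_prod (fun i x => Real.exp (s * l i * (x ^ 2 - 1)))]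
  simp only [← Real.exp_sum, mul_assoc, ← Finset.mul_sum]

lemma lt_measureReal_le_sum_mul_sq_sub_one_of_forall_mul_le {ι : Type*} [Fintype ι] {l : ι → ℝ}
    (hl : ∀ i, 0 ≤ l i) {F t : ℝ} (hF : 0 < F) (hFl : F ^ 2 = ∑ i, l i ^ 2) (ht : 128 ≤ t ^ 2)
    (ht0 : 0 < t) (h : ∀ i, l i * t ≤ F) :
    Real.exp (-t ^ 2) / 2 < (Measure.pi fun _ : ι => gaussianReal 0 1).real
      {x | t / 16 * F ≤ ∑ i, l i * (x i ^ 2 - 1)} := by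
  set s := t / (8 * F) with hs
  have hs0 : 0 < s := by positivity
  have hsl : ∀ i, s * l i ≤ 1 / 8 := fun i => by
    rw [hs, div_mul_eq_mul_div, div_le_iff₀ (by positivity)]
    linarith [h i]
  have hsl0 : ∀ i, 0 ≤ s * l i := fun i => mul_nonneg hs0.le (hl i)
  have hsum : ∑ i, (s * l i) ^ 2 = t ^ 2 / 64 := by
    simp_rw [mul_pow, ← Finset.mul_sum, ← hFl, hs]
    field_simp; norm_num
  set μ := Measure.pi fun _ : ι => gaussianReal 0 1 with hμ
  set X := fun x : ι → ℝ => Real.exp (s * ∑ i, l i * (x i ^ 2 - 1)) with hX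
  have hX2 : (fun x => X x ^ 2) =
      fun x : ι → ℝ => Real.exp (2 * s * ∑ i, l i * (x i ^ 2 - 1)) := by
    ext x
    rw [hX, ← Real.exp_nat_mul]
    push_cast
    ring_nf
  have hm : Measurable X := by fun_prop
  have hlow : Real.exp (t ^ 2 / 64) ≤ ∫ x, X x ∂μ := by
    rw [hX, integral_exp_mul_sum_mul_sq_sub_one, ← hsum, Real.exp_sum]
    exact Finset.prod_le_prod (fun i _ => by positivity) fun i _ =>
      exp_sq_le_integral_exp_mul_sq_sub_one (hsl0 i) (by linarith [hsl i])
  have hupp : ∫ x, X x ^ 2 ∂μ ≤ Real.exp (t ^ 2 / 4) := by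
    rw [hX2, integral_exp_mul_sum_mul_sq_sub_one,
      show t ^ 2 / 4 = ∑ i, 4 * (2 * s * l i) ^ 2 by
        simp_rw [mul_assoc (2 : ℝ), mul_pow (2 : ℝ), ← Finset.mul_sum, hsum]; ring, Real.exp_sum]
    exact Finset.prod_le_prod (fun i _ => integral_nonneg fun x => by positivity) fun i _ =>
      integral_exp_mul_sq_sub_one_le (by linarith [hsl0 i]) (by linarith [hsl i])
  have key := le_measureReal_half_integral_le hm
    (integrable_exp_mul_sum_mul_sq_sub_one fun i => by linarith [hsl i])
    (by rw [hX2]; exact integrable_exp_mul_sum_mul_sq_sub_one fun i => by linarith [hsl i])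
    ((Real.exp_pos _).trans_le hlow) hupp (Real.exp_pos _)
  have hexp : (2 : ℝ) < Real.exp (t ^ 2 / 128) := by
    have : Real.exp 1 ≤ Real.exp (t ^ 2 / 128) := Real.exp_le_exp.2 (by linarith)
    linarith [Real.exp_one_gt_d9]
  have hsub : {x | (∫ x, X x ∂μ) / 2 ≤ X x} ⊆ {x | t / 16 * F ≤ ∑ i, l i * (x i ^ 2 - 1)} := by
    intro x hx
    have h1 : Real.exp (t ^ 2 / 128) ≤ X x := by
      have h2 : Real.exp (t ^ 2 / 64) = Real.exp (t ^ 2 / 128) * Real.exp (t ^ 2 / 128) := by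
        rw [← Real.exp_add]; ring_nf
      have h3 : (∫ x, X x ∂μ) / 2 ≤ X x := hx
      nlinarith
    have h2 : t ^ 2 / 128 ≤ s * ∑ i, l i * (x i ^ 2 - 1) := Real.exp_le_exp.1 h1
    have h3 : t ^ 2 / 128 = s * (t / 16 * F) := by rw [hs]; field_simp; norm_num
    rw [h3] at h2
    exact le_of_mul_le_mul_left h2 hs0
  refine lt_of_lt_of_le ?_ (key.trans (measureReal_mono hsub))
  calc Real.exp (-t ^ 2) / 2 < Real.exp (-t ^ 2) * Real.exp (t ^ 2 / 128) / 4 := by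
        nlinarith [Real.exp_pos (-t ^ 2)]
    _ ≤ Real.exp (t ^ 2 / 64) ^ 2 / (4 * Real.exp (t ^ 2 / 4)) := by
        rw [le_div_iff₀ (by positivity), ← Real.exp_nat_mul, ← Real.exp_add, div_mul_eq_mul_div,
          mul_left_comm, ← Real.exp_add, mul_div_cancel_left₀ _ (by norm_num)]
        gcongr
        push_cast
        nlinarith
    _ ≤ _ := by gcongr

lemma memLp_sq_sub_one_gaussianReal :
    MemLp (fun x : ℝ => x ^ 2 - 1) 2 (gaussianReal 0 1) := by
  have h : MemLp (id : ℝ → ℝ) 4 (gaussianReal 0 1) := memLp_id_gaussianReal' 4 (by simp)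
  refine MemLp.sub ?_ (memLp_const 1)
  rw [memLp_two_iff_integrable_sq (by fun_prop)]
  have := h.integrable_norm_pow (by norm_num)
  refine this.congr (ae_of_all _ fun x => ?_)
  simp only [id, Real.norm_eq_abs, ← pow_mul]
  norm_num
  exact Even.pow_abs (by decide) x

lemma integral_sq_sub_one_gaussianReal : ∫ x : ℝ, (x ^ 2 - 1) ∂(gaussianReal 0 1) = 0 := by
  have h2 : MemLp (fun x : ℝ => x) 2 (gaussianReal 0 1) := memLp_id_gaussianReal' 2 (by simp)
  have h := variance_fun_id_gaussianReal (μ := 0) (v := 1)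
  rw [variance_eq_sub h2, integral_id_gaussianReal] at h
  rw [integral_sub h2.integrable_sq (integrable_const 1)]
  simpa [sub_eq_zero] using h

section WeightedSum

variable {ι : Type*} [Fintype ι] (l : ι → ℝ)

lemma memLp_sum_mul_sq_sub_one :
    MemLp (fun x : ι → ℝ => ∑ i, l i * (x i ^ 2 - 1)) 2
      (Measure.pi fun _ : ι => gaussianReal 0 1) :=
  memLp_finsetSum _ fun i _ => (memLp_sq_sub_one_gaussianReal.comp_measurePreserving
    (measurePreserving_eval (fun _ : ι => gaussianReal 0 1) i)).const_mul (l i)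

lemma integral_sum_mul_sq_sub_one :
    ∫ x, ∑ i, l i * (x i ^ 2 - 1) ∂(Measure.pi fun _ : ι => gaussianReal 0 1) = 0 := by
  rw [integral_finsetSum]
  · refine Finset.sum_eq_zero fun i _ => ?_
    rw [integral_const_mul,
      integral_comp_eval (μ := fun _ : ι => gaussianReal 0 1) (i := i)
        (f := fun x : ℝ => x ^ 2 - 1) (by fun_prop), integral_sq_sub_one_gaussianReal, mul_zero]
  · exact fun i _ => ((memLp_sq_sub_one_gaussianReal.comp_measurePreserving
      (measurePreserving_eval (fun _ : ι => gaussianReal 0 1) i)).const_mul (l i)).integrable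
        (by norm_num)

lemma variance_sum_mul_sq_sub_one :
    Var[fun x => ∑ i, l i * (x i ^ 2 - 1); Measure.pi fun _ : ι => gaussianReal 0 1] =
      (∑ i, l i ^ 2) * Var[fun x => x ^ 2 - 1; gaussianReal 0 1] := by
  have h := variance_sum_pi (μ := fun _ : ι => gaussianReal 0 1)
    (X := fun i x => l i * (x ^ 2 - 1)) fun i => memLp_sq_sub_one_gaussianReal.const_mul (l i)
  simp_rw [variance_const_mul, ← Finset.sum_mul] at h
  rw [← h]
  congr 1
  ext x
  simp

end WeightedSum

lemma lt_measureReal_le_sum_mul_sq_sub_one_of_lt_mul {ι : Type*} [Fintype ι] {l : ι → ℝ}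
    {F t : ℝ} (hF : 0 < F) (hFl : F ^ 2 = ∑ i, l i ^ 2)
    (ht0 : 0 < t) (ht : 128 ≤ t ^ 2)
    (htV : 512 * Var[fun x => x ^ 2 - 1; gaussianReal 0 1] < t ^ 2)
    {i : ι} (h : F < l i * t) :
    Real.exp (-t ^ 2) / 2 < (Measure.pi fun _ : ι => gaussianReal 0 1).real
      {x | t / 16 * F ≤ ∑ i, l i * (x i ^ 2 - 1)} := by
  classical
  set V := Var[fun x => x ^ 2 - 1; gaussianReal 0 1] with hV
  set μ := Measure.pi fun _ : ι => gaussianReal 0 1 with hμ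
  have hV0 : 0 ≤ V := variance_nonneg _ _
  have hli : 0 < l i := pos_of_mul_pos_left (hF.trans h) ht0.le
  set Y : ι → (ι → ℝ) → ℝ := fun j x => l j * (x j ^ 2 - 1) with hY
  set R : (ι → ℝ) → ℝ := ∑ j ∈ Finset.univ.erase i, Y j with hR
  have hindep : R ⟂ᵢ[μ] Y i := by
    have h1 : iIndepFun Y μ := iIndepFun_pi (μ := fun _ : ι => gaussianReal 0 1)
      (X := fun j x => l j * (x ^ 2 - 1)) fun j => by fun_prop
    exact h1.indepFun_finsetSum_of_notMem (fun j => by fun_prop) (Finset.notMem_erase i _)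
  have hR' : R = fun x => ∑ j, Function.update l i 0 j * (x j ^ 2 - 1) := by
    ext x
    rw [hR, Finset.sum_apply, ← Finset.add_sum_erase _ _ (Finset.mem_univ i)]
    simp only [Function.update_self, zero_mul, zero_add]
    refine Finset.sum_congr rfl fun j hj => ?_
    rw [Function.update_of_ne (Finset.ne_of_mem_erase hj)]
  have hRm : Measurable R := by rw [hR']; fun_prop
  have hVR : Var[R; μ] ≤ F ^ 2 * V := by
    rw [hR', variance_sum_mul_sq_sub_one, hFl]
    refine mul_le_mul_of_nonneg_right (Finset.sum_le_sum fun j _ => ?_) hV0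
    by_cases hj : j = i
    · subst hj; simp [sq_nonneg]
    · simp [hj]
  have hcheb : μ.real {x | t / 16 * F ≤ |R x|} < 1 / 2 := by
    have h1 := meas_ge_le_variance_div_sq (μ := μ) (X := R)
      (by rw [hR']; exact memLp_sum_mul_sq_sub_one _) (show 0 < t / 16 * F by positivity)
    have h2 : ∫ x, R x ∂μ = 0 := by rw [hR']; exact integral_sum_mul_sq_sub_one _
    simp only [h2, sub_zero] at h1
    refine (ENNReal.toReal_le_of_le_ofReal (div_nonneg (variance_nonneg _ _) (sq_nonneg _)) h1).trans_lt ?_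
    calc Var[R; μ] / (t / 16 * F) ^ 2 ≤ F ^ 2 * V / (t / 16 * F) ^ 2 := by gcongr
      _ = 256 * V / t ^ 2 := by field_simp; norm_num
      _ < 1 / 2 := by rw [div_lt_div_iff₀ (by positivity) (by norm_num)]; linarith
  have hRprob : 1 / 2 < μ.real (R ⁻¹' Set.Ici (-(t / 16 * F))) := by
    have h1 : (R ⁻¹' Set.Ici (-(t / 16 * F)))ᶜ ⊆ {x | t / 16 * F ≤ |R x|} := by
      intro x hx
      simp only [Set.mem_compl_iff, Set.mem_preimage, Set.mem_Ici, not_le] at hx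
      exact (by linarith : t / 16 * F ≤ -R x).trans (neg_le_abs _)
    have h2 := measureReal_mono (μ := μ) h1
    rw [probReal_compl_eq_one_sub (hRm measurableSet_Ici)] at h2
    linarith
  have hYprob : Real.exp (-t ^ 2) ≤ μ.real (Y i ⁻¹' Set.Ici (t / 8 * F)) := by
    refine (exp_neg_sq_le_gaussianReal (t := t) (by nlinarith)).trans ?_
    have h1 : (gaussianReal 0 1).real (Set.Ici (t / 2)) =
        μ.real ((fun x : ι → ℝ => x i) ⁻¹' Set.Ici (t / 2)) := by
      rw [measureReal_def, measureReal_def, ← (measurePreserving_eval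
        (fun _ : ι => gaussianReal 0 1) i).measure_preimage measurableSet_Ici.nullMeasurableSet]
    rw [h1]
    refine measureReal_mono fun x hx => ?_
    simp only [Set.mem_preimage, Set.mem_Ici] at hx
    have h2 : t ^ 2 / 8 ≤ x i ^ 2 - 1 := by nlinarith
    calc t / 8 * F ≤ t / 8 * (l i * t) := by gcongr
      _ = l i * (t ^ 2 / 8) := by ring
      _ ≤ l i * (x i ^ 2 - 1) := by gcongr
  have hsub : R ⁻¹' Set.Ici (-(t / 16 * F)) ∩ Y i ⁻¹' Set.Ici (t / 8 * F) ⊆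
      {x | t / 16 * F ≤ ∑ i, l i * (x i ^ 2 - 1)} := by
    rintro x ⟨hx1, hx2⟩
    have h1 : ∑ i, l i * (x i ^ 2 - 1) = Y i x + R x := by
      rw [← Finset.add_sum_erase _ _ (Finset.mem_univ i), hR, Finset.sum_apply]
    simp only [Set.mem_preimage, Set.mem_Ici] at hx1 hx2
    rw [Set.mem_ofPred_eq, h1]
    linarith
  refine lt_of_lt_of_le ?_ (measureReal_mono hsub)
  have hmul : μ.real (R ⁻¹' Set.Ici (-(t / 16 * F)) ∩ Y i ⁻¹' Set.Ici (t / 8 * F)) =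
      μ.real (R ⁻¹' Set.Ici (-(t / 16 * F))) * μ.real (Y i ⁻¹' Set.Ici (t / 8 * F)) := by
    simp only [measureReal_def]
    rw [hindep.measure_inter_preimage_eq_mul _ _ measurableSet_Ici measurableSet_Ici,
      ENNReal.toReal_mul]
  rw [hmul]
  nlinarith [Real.exp_pos (-t ^ 2)]

lemma lt_measureReal_le_abs_sum_mul_sq_sub_one {ι : Type*} [Fintype ι] {l : ι → ℝ}
    (hl : ∀ i, 0 ≤ l i) {t : ℝ} (ht0 : 0 < t)
    (ht : 128 + 512 * Var[fun x => x ^ 2 - 1; gaussianReal 0 1] < t ^ 2) :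
    Real.exp (-t ^ 2) / 2 < (Measure.pi fun _ : ι => gaussianReal 0 1).real
      {x | t / 16 * √(∑ i, l i ^ 2) ≤ |∑ i, l i * (x i ^ 2 - 1)|} := by
  have hV0 : 0 ≤ Var[fun x => x ^ 2 - 1; gaussianReal 0 1] := variance_nonneg _ _
  have hFl : √(∑ i, l i ^ 2) ^ 2 = ∑ i, l i ^ 2 :=
    Real.sq_sqrt (Finset.sum_nonneg fun i _ => sq_nonneg _)
  rcases (Real.sqrt_nonneg (∑ i, l i ^ 2)).eq_or_lt with hF | hF
  · have hexp : Real.exp (-t ^ 2) ≤ 1 := Real.exp_le_one_iff.2 (by nlinarith)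
    have huniv : {x : ι → ℝ | t / 16 * √(∑ i, l i ^ 2) ≤ |∑ i, l i * (x i ^ 2 - 1)|} =
        Set.univ := by
      ext x
      simp [← hF]
    rw [huniv, probReal_univ]
    linarith
  · have hsub : {x : ι → ℝ | t / 16 * √(∑ i, l i ^ 2) ≤ ∑ i, l i * (x i ^ 2 - 1)} ⊆
        {x : ι → ℝ | t / 16 * √(∑ i, l i ^ 2) ≤ |∑ i, l i * (x i ^ 2 - 1)|} := by
      intro x hx
      rw [Set.mem_ofPred_eq] at hx ⊢
      exact hx.trans (le_abs_self _)
    refine lt_of_lt_of_le ?_ (measureReal_mono hsub)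
    by_cases h : ∃ i, √(∑ i, l i ^ 2) < l i * t
    · obtain ⟨i, hi⟩ := h
      exact lt_measureReal_le_sum_mul_sq_sub_one_of_lt_mul hF hFl ht0 (by linarith) (by linarith) hi
    · push Not at h
      exact lt_measureReal_le_sum_mul_sq_sub_one_of_forall_mul_le hl hF hFl (by linarith) ht0 h

/-- There are universal constants `c₁, δ₀ > 0` such that: for positive
integers `d, n`, a matrix `A ∈ ℝ^{d×n}`, `g ∈ ℝ^n` a standard gaussian vector, and any
`0 < δ < δ₀`: `Pr(|‖Ag‖₂² − tr(AᵀA)| ≥ c₁√(ln(1/δ)) ‖AᵀA‖_F) > δ/2`. -/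
theorem stmt7 :
    ∃ c₁ δ₀ : ℝ, 0 < c₁ ∧ 0 < δ₀ ∧
      ∀ (d n : ℕ), 0 < d → 0 < n → ∀ A : Matrix (Fin d) (Fin n) ℝ,
        ∀ δ : ℝ, 0 < δ → δ < δ₀ →
          ENNReal.ofReal (δ / 2) <
            (Measure.pi fun _ : Fin n => gaussianReal 0 1)
              {g | c₁ * Real.sqrt (Real.log (1/δ)) * frobNorm (Aᵀ * A) ≤
                    |(∑ i, (A.mulVec g i)^2) - (Aᵀ * A).trace|} := by
  set V := Var[fun x => x ^ 2 - 1; gaussianReal 0 1] with hV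
  have hV0 : 0 ≤ V := variance_nonneg _ _
  refine ⟨1 / 16, Real.exp (-(128 + 512 * V)), by norm_num, Real.exp_pos _, ?_⟩
  intro d n _ _ A δ hδ hδ₀
  have hlog : 128 + 512 * V < Real.log (1 / δ) := by
    rw [one_div, Real.log_inv]
    linarith [(Real.log_lt_iff_lt_exp hδ).2 hδ₀]
  set t := √(Real.log (1 / δ)) with ht
  have ht0 : 0 < t := Real.sqrt_pos.2 (by linarith)
  have ht2 : t ^ 2 = Real.log (1 / δ) := Real.sq_sqrt (by linarith)
  have hexp : Real.exp (-t ^ 2) = δ := by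
    rw [ht2, one_div, Real.log_inv, neg_neg, Real.exp_log hδ]
  have hpsd : (Aᵀ * A).PosSemidef := by
    simpa using posSemidef_conjTranspose_mul_self A
  have hM := hpsd.isHermitian
  have key := lt_measureReal_le_abs_sum_mul_sq_sub_one hpsd.eigenvalues_nonneg ht0
    (by rw [ht2]; exact hlog)
  have htr : (Aᵀ * A).trace = ∑ i, hM.eigenvalues i := by
    simpa using hM.trace_eq_sum_eigenvalues
  rw [hexp] at key
  rw [ENNReal.ofReal_lt_iff_lt_toReal (by positivity) (measure_ne_top _ _), ← measureReal_def]
  conv_rhs => rw [← map_mulVec_eigenvectorUnitary_pi_gaussianReal hM]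
  rw [map_measureReal_apply (by fun_prop) (measurableSet_le (by fun_prop)
    (by simp only [mulVec, dotProduct]; fun_prop))]
  refine key.trans_eq (congrArg _ ?_)
  ext x
  simp only [Set.mem_preimage, Set.mem_ofPred_eq]
  rw [sum_mulVec_eigenvectorUnitary_sq, htr, frobNorm_eq_sqrt_sum_eigenvalues_sq hM,
    ← Finset.sum_sub_distrib]
  simp only [mul_sub, mul_one]
  rw [one_div_mul_eq_div]
end
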